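/- arXiv:1307.8040 — 3 statements merged into one kernel-verified Lean document; each statement's English description precedes it below -/
import Mathlib

section
/- Let l,m≥1 be integers with (nL+1)T<1, where T=(r+τ)/m. Then there exists a constant K=K(m)≥0, independent of l, such that for every u∈L^∞([0,r+τ];ℝ) and every x∈ℝⁿ: |P^u_{l,m}x − φ(r+τ,x;u)| ≤ K·((nL+1)T)^{l+1}/(1−(nL+1)T)·( |x| + sup_{0≤s<r+τ}|u(s)| ), where φ(t,x;u) denotes the unique solution of the delay-free system (1.5) at time t with initial condition x and input u. (Proposition 2.1) -/
open MeasureTheory Set Matrix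

/-- Euclidean norm on `Fin n → ℝ`. -/
noncomputable def vnorm {n : ℕ} (v : Fin n → ℝ) : ℝ := Real.sqrt (∑ i, v i ^ 2)

/-- The vector `c = (1,0,…,0)'`. -/
def cvec (n : ℕ) : Fin n → ℝ := fun i => if (i : ℕ) = 0 then 1 else 0

/-- The vector `b = (0,…,0,1)'`. -/
def bvec (n : ℕ) : Fin n → ℝ := fun i => if (i : ℕ) + 1 = n then 1 else 0

/-- `(AshiftU v a) i = v (i+1)` for `i < n-1`, and `= a` for `i = n-1`:
the superdiagonal shift `A·v` with the last slot replaced by `a`. -/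
def AshiftU {n : ℕ} (v : Fin n → ℝ) (a : ℝ) : Fin n → ℝ :=
  fun i => if h : (i : ℕ) + 1 < n then v ⟨(i : ℕ) + 1, h⟩ else a

/-- Induced (spectral) norm of a matrix. -/
noncomputable def matNorm {n : ℕ} (Q : Matrix (Fin n) (Fin n) ℝ) : ℝ :=
  sSup {c : ℝ | ∃ v : Fin n → ℝ, vnorm v = 1 ∧ c = vnorm (Q.mulVec v)}

/-- The superdiagonal shift matrix `A`. -/
def Amat (n : ℕ) : Matrix (Fin n) (Fin n) ℝ :=
  Matrix.of fun i j => if (i : ℕ) + 1 = (j : ℕ) then 1 else 0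

/-- The constant `ω` of Lemma 2.3. -/
noncomputable def omegaConst (n : ℕ) (L θ : ℝ) (p : Fin n → ℝ) : ℝ :=
  (max (L * ((n : ℝ) + 1) + 2 + 2 * (n : ℝ) *
      (⨆ i : Fin n, θ ^ (2 * ((i : ℕ) + 1)) * (p i) ^ 2)) (1 + L ^ 2)) / 2

/-- The operator `P_{T,u}` of (2.6) (as an operator on functions `ℝ → ℝⁿ`). -/
noncomputable def Pop {n : ℕ} (f : Fin n → (Fin n → ℝ) → ℝ) (u : ℝ → ℝ)
    (x : ℝ → Fin n → ℝ) : ℝ → Fin n → ℝ :=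
  fun t => x 0 + ∫ s in (0:ℝ)..t, ((fun i => f i (x s)) + AshiftU (x s) 0 + u s • bvec n)

/-- The operator `Q^l_{T,u} = C_T ∘ P^l_{T,u} ∘ G_T` of (2.8). -/
noncomputable def Qop {n : ℕ} (f : Fin n → (Fin n → ℝ) → ℝ) (u : ℝ → ℝ) (l : ℕ) (T : ℝ)
    (x₀ : Fin n → ℝ) : Fin n → ℝ :=
  ((Pop f u)^[l] (fun _ => x₀)) T

/-- `PredIter f l T u m = Q^l_{T,u_m} ∘ ⋯ ∘ Q^l_{T,u_1}`, i.e. the map `P^u_{l,m}` of (2.9),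
where `u_i(s) = u(s + (i-1)T)`. -/
noncomputable def PredIter {n : ℕ} (f : Fin n → (Fin n → ℝ) → ℝ) (l : ℕ) (T : ℝ)
    (u : ℝ → ℝ) : ℕ → (Fin n → ℝ) → (Fin n → ℝ)
  | 0 => id
  | (m + 1) => fun x => Qop f (fun s => u (s + (m : ℝ) * T)) l T (PredIter f l T u m x)

/-- The right-hand side of the delay-free system. -/
noncomputable def Frhs {n : ℕ} (f : Fin n → (Fin n → ℝ) → ℝ) (x : Fin n → ℝ) (a : ℝ) :
    Fin n → ℝ :=
  (fun i => f i x) + AshiftU x 0 + a • bvec n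

lemma norm_le_vnorm {n : ℕ} (v : Fin n → ℝ) : ‖v‖ ≤ vnorm v := by
  refine (pi_norm_le_iff_of_nonneg (Real.sqrt_nonneg _)).2 fun i => ?_
  rw [Real.norm_eq_abs]
  apply Real.abs_le_sqrt
  exact Finset.single_le_sum (f := fun i => v i ^ 2) (fun i _ => sq_nonneg _) (Finset.mem_univ i)

lemma vnorm_le_norm {n : ℕ} (v : Fin n → ℝ) : vnorm v ≤ n * ‖v‖ := by
  unfold vnorm
  apply Real.sqrt_le_iff.2 ⟨by positivity, ?_⟩
  have h1 : ∑ i, v i ^ 2 ≤ ∑ _i : Fin n, ‖v‖ ^ 2 := by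
    apply Finset.sum_le_sum
    intro i _
    have := norm_le_pi_norm v i
    rw [Real.norm_eq_abs] at this
    rw [← sq_abs]
    gcongr
  rw [Finset.sum_const, Finset.card_univ, Fintype.card_fin, nsmul_eq_mul] at h1
  have h2 : (n : ℝ) ≤ (n : ℝ) ^ 2 := by
    exact_mod_cast Nat.le_self_pow two_ne_zero n
  rw [mul_pow]
  exact h1.trans (by gcongr)

section field
variable {n : ℕ} {L : ℝ} {f : Fin n → (Fin n → ℝ) → ℝ}

lemma f_lip (hL : 0 ≤ L) (hfLip : ∀ (i : Fin n) (x z : Fin n → ℝ),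
      |f i x - f i z| ≤ L * vnorm (fun j => if (j : ℕ) ≤ (i : ℕ) then x j - z j else 0))
    (i : Fin n) (x z : Fin n → ℝ) : |f i x - f i z| ≤ n * L * ‖x - z‖ := by
  refine (hfLip i x z).trans ?_
  have h := vnorm_le_norm (fun j : Fin n => if (j : ℕ) ≤ (i : ℕ) then x j - z j else 0)
  have h2 : ‖(fun j : Fin n => if (j : ℕ) ≤ (i : ℕ) then x j - z j else 0)‖ ≤ ‖x - z‖ := by
    refine (pi_norm_le_iff_of_nonneg (norm_nonneg _)).2 fun j => ?_
    split_ifs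
    · exact norm_le_pi_norm (x - z) j
    · simp
  calc _ ≤ L * (n * ‖x - z‖) := by
        gcongr
        exact h.trans (by gcongr)
    _ = _ := by ring

lemma ashift_norm (x : Fin n → ℝ) (i : Fin n) : |AshiftU x 0 i| ≤ ‖x‖ := by
  unfold AshiftU
  split_ifs
  · exact norm_le_pi_norm x _
  · simp

lemma F_lip (hL : 0 ≤ L) (hfLip : ∀ (i : Fin n) (x z : Fin n → ℝ),
      |f i x - f i z| ≤ L * vnorm (fun j => if (j : ℕ) ≤ (i : ℕ) then x j - z j else 0))
    (x z : Fin n → ℝ) (a : ℝ) : ‖Frhs f x a - Frhs f z a‖ ≤ (n * L + 1) * ‖x - z‖ := by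
  refine (pi_norm_le_iff_of_nonneg (by positivity)).2 fun i => ?_
  have h1 := f_lip hL hfLip i x z
  have h2 := ashift_norm (x - z) i
  have h3 : AshiftU (x - z) 0 i = AshiftU x 0 i - AshiftU z 0 i := by
    unfold AshiftU
    split_ifs <;> simp
  have h4 : (Frhs f x a - Frhs f z a) i = (f i x - f i z) + AshiftU (x - z) 0 i := by
    rw [h3]; simp only [Frhs, Pi.sub_apply, Pi.add_apply]; ring
  rw [h4, Real.norm_eq_abs]
  refine (abs_add_le _ _).trans ?_
  linarith

lemma F_bound (hL : 0 ≤ L) (hfLip : ∀ (i : Fin n) (x z : Fin n → ℝ),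
      |f i x - f i z| ≤ L * vnorm (fun j => if (j : ℕ) ≤ (i : ℕ) then x j - z j else 0))
    (hf0 : ∀ i, f i (fun _ => 0) = 0)
    (x : Fin n → ℝ) (a : ℝ) : ‖Frhs f x a‖ ≤ (n * L + 1) * (‖x‖ + |a|) := by
  refine (pi_norm_le_iff_of_nonneg (by positivity)).2 fun i => ?_
  have h1 := f_lip hL hfLip i x (fun _ => 0)
  rw [hf0, sub_zero, show x - (fun _ => (0:ℝ)) = x from sub_zero x] at h1
  have h2 := ashift_norm x i
  have h3 : |a * bvec n i| ≤ |a| := by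
    unfold bvec
    split_ifs <;> simp
  have h4 : Frhs f x a i = f i x + AshiftU x 0 i + a * bvec n i := by
    simp [Frhs]
  rw [h4, Real.norm_eq_abs]
  refine (abs_add_three _ _ _).trans ?_
  have : 0 ≤ n * L * |a| := by positivity
  nlinarith

lemma F_cont (hL : 0 ≤ L) (hfLip : ∀ (i : Fin n) (x z : Fin n → ℝ),
      |f i x - f i z| ≤ L * vnorm (fun j => if (j : ℕ) ≤ (i : ℕ) then x j - z j else 0)) :
    Continuous (fun x => Frhs f x 0) := by
  have : LipschitzWith (Real.toNNReal (n * L + 1)) (fun x => Frhs f x 0) := by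
    apply LipschitzWith.of_dist_le_mul
    intro x z
    rw [dist_eq_norm, dist_eq_norm, Real.coe_toNNReal _ (by positivity)]
    exact F_lip hL hfLip x z 0
  exact this.continuous

lemma u_int {v : ℝ → ℝ} {T U : ℝ} (hT : 0 < T) (hv : Measurable v)
    (hU : ∀ s ∈ Ico 0 T, |v s| ≤ U) : IntervalIntegrable v volume 0 T := by
  rw [intervalIntegrable_iff_integrableOn_Ico_of_le hT.le]
  refine Measure.integrableOn_of_bounded (M := U) (by simp) hv.aestronglyMeasurable ?_
  exact (ae_restrict_mem measurableSet_Ico).mono fun s hs => hU s hs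

lemma F_int (hL : 0 ≤ L) (hfLip : ∀ (i : Fin n) (x z : Fin n → ℝ),
      |f i x - f i z| ≤ L * vnorm (fun j => if (j : ℕ) ≤ (i : ℕ) then x j - z j else 0))
    {v : ℝ → ℝ} {T U : ℝ} (hT : 0 < T) (hv : Measurable v)
    (hU : ∀ s ∈ Ico 0 T, |v s| ≤ U) {y : ℝ → Fin n → ℝ} (hy : ContinuousOn y (Icc 0 T)) :
    IntervalIntegrable (fun s => Frhs f (y s) (v s)) volume 0 T := by
  have h1 : IntervalIntegrable (fun s => Frhs f (y s) 0) volume 0 T := by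
    apply ContinuousOn.intervalIntegrable
    rw [uIcc_of_le hT.le]
    exact (F_cont hL hfLip).comp_continuousOn hy
  have h2 : IntervalIntegrable (fun s => v s • bvec n) volume 0 T := by
    have := u_int hT hv hU
    rw [intervalIntegrable_iff] at this ⊢
    exact this.smul_const _
  have h3 : (fun s => Frhs f (y s) (v s)) = fun s => Frhs f (y s) 0 + v s • bvec n := by
    funext s
    simp [Frhs]
  rw [h3]
  exact h1.add h2

lemma int_sub {y : ℝ → Fin n → ℝ} {T t : ℝ} (h : IntervalIntegrable y volume 0 T)
    (ht : t ∈ Icc 0 T) : IntervalIntegrable y volume 0 t := by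
  apply h.mono_set
  rw [uIcc_of_le ht.1, uIcc_of_le (ht.1.trans ht.2)]
  exact Icc_subset_Icc_right ht.2

/-- A priori bound on one segment. -/
lemma seg_bound (hL : 0 ≤ L) (hfLip : ∀ (i : Fin n) (x z : Fin n → ℝ),
      |f i x - f i z| ≤ L * vnorm (fun j => if (j : ℕ) ≤ (i : ℕ) then x j - z j else 0))
    (hf0 : ∀ i, f i (fun _ => 0) = 0)
    {v : ℝ → ℝ} {T U : ℝ} (hT : 0 < T) (hq : (n * L + 1) * T < 1)
    (hU : ∀ s ∈ Ico 0 T, |v s| ≤ U) {y : ℝ → Fin n → ℝ} (hy : ContinuousOn y (Icc 0 T))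
    (hsol : ∀ t ∈ Icc 0 T, y t = y 0 + ∫ s in (0:ℝ)..t, Frhs f (y s) (v s)) :
    ∃ B : ℝ, 0 ≤ B ∧ B ≤ (1 - (n * L + 1) * T)⁻¹ * (‖y 0‖ + U) ∧
      (∀ t ∈ Icc 0 T, ‖y t‖ + U ≤ B) ∧
      (∀ t ∈ Icc 0 T, ‖y 0 - y t‖ ≤ (n * L + 1) * T * B) := by
  obtain ⟨t0, ht0, hmax⟩ := isCompact_Icc.exists_isMaxOn (nonempty_Icc.2 hT.le) hy.norm
  have hM : ∀ t ∈ Icc 0 T, ‖y t‖ ≤ ‖y t0‖ := fun t ht => hmax ht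
  have hU0 : 0 ≤ U := (abs_nonneg _).trans (hU 0 ⟨le_rfl, hT⟩)
  have key : ∀ t ∈ Icc 0 T, ‖y 0 - y t‖ ≤ (n * L + 1) * T * (‖y t0‖ + U) := by
    intro t ht
    rw [norm_sub_rev, hsol t ht, add_sub_cancel_left]
    have hh : ‖∫ s in (0:ℝ)..t, Frhs f (y s) (v s)‖
        ≤ ((n * L + 1) * (‖y t0‖ + U)) * |t - 0| := by
      apply intervalIntegral.norm_integral_le_of_norm_le_const_ae
      have hne : ∀ᵐ s : ℝ, s ≠ T := by simp [ae_iff]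
      filter_upwards [hne] with s hs hst
      rw [uIoc_of_le ht.1] at hst
      have hs1 : s ≤ T := hst.2.trans ht.2
      refine (F_bound hL hfLip hf0 _ _).trans ?_
      gcongr
      · exact hM s ⟨hst.1.le, hs1⟩
      · exact hU s ⟨hst.1.le, lt_of_le_of_ne hs1 hs⟩
    rw [sub_zero, abs_of_nonneg ht.1] at hh
    refine hh.trans ?_
    calc _ ≤ ((n * L + 1) * (‖y t0‖ + U)) * T := by
          gcongr
          exact ht.2
      _ = _ := by ring
  refine ⟨‖y t0‖ + U, by positivity, ?_, fun t ht => by linarith [hM t ht], key⟩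
  rw [inv_mul_eq_div, le_div_iff₀ (by linarith)]
  have h1 := key t0 ht0
  have h2 : ‖y t0‖ ≤ ‖y 0‖ + ‖y 0 - y t0‖ := by
    have := norm_sub_le (y 0) (y 0 - y t0)
    rwa [sub_sub_cancel] at this
  linarith

lemma seg_iter (hL : 0 ≤ L) (hfLip : ∀ (i : Fin n) (x z : Fin n → ℝ),
      |f i x - f i z| ≤ L * vnorm (fun j => if (j : ℕ) ≤ (i : ℕ) then x j - z j else 0))
    {v : ℝ → ℝ} {T U B : ℝ} (hT : 0 < T) (hq : (n * L + 1) * T < 1) (hv : Measurable v)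
    (hU : ∀ s ∈ Ico 0 T, |v s| ≤ U) {y : ℝ → Fin n → ℝ} (hy : ContinuousOn y (Icc 0 T))
    (hsol : ∀ t ∈ Icc 0 T, y t = y 0 + ∫ s in (0:ℝ)..t, Frhs f (y s) (v s))
    (hB0 : 0 ≤ B) (hB : ∀ t ∈ Icc 0 T, ‖y 0 - y t‖ ≤ (n * L + 1) * T * B)
    (x₀ : Fin n → ℝ) (k : ℕ) :
    ContinuousOn ((Pop f v)^[k] (fun _ => x₀)) (Icc 0 T) ∧
    (Pop f v)^[k] (fun _ => x₀) 0 = x₀ ∧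
    ∀ t ∈ Icc 0 T, ‖(Pop f v)^[k] (fun _ => x₀) t - y t‖ ≤
      (1 - (n * L + 1) * T)⁻¹ * ‖x₀ - y 0‖ + ((n * L + 1) * T) ^ (k + 1) * B := by
  set q : ℝ := (n * L + 1) * T with hqdef
  have hq0 : 0 ≤ q := by positivity
  have hρ : (1 - q)⁻¹ = 1 + q * (1 - q)⁻¹ := by
    have : 1 - q ≠ 0 := by linarith
    field_simp
    ring
  have hρ0 : 0 ≤ (1 - q)⁻¹ := inv_nonneg.2 (by linarith)
  induction k with
  | zero =>
    refine ⟨continuousOn_const, rfl, fun t ht => ?_⟩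
    simp only [Function.iterate_zero, id_eq, zero_add, pow_one]
    have h1 := hB t ht
    have h2 : x₀ - y t = (x₀ - y 0) + (y 0 - y t) := by abel
    rw [h2]
    refine (norm_add_le _ _).trans ?_
    have : 0 ≤ q * (1 - q)⁻¹ * ‖x₀ - y 0‖ := by positivity
    rw [hρ]
    linarith
  | succ k ih =>
    rw [Function.iterate_succ_apply']
    set Z := (Pop f v)^[k] (fun _ => x₀) with hZ
    obtain ⟨hc, h0, hb⟩ := ih
    have hiZ := F_int hL hfLip hT hv hU hc
    have hiy := F_int hL hfLip hT hv hU hy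
    have hP : ∀ t, Pop f v Z t = x₀ + ∫ s in (0:ℝ)..t, Frhs f (Z s) (v s) := by
      intro t
      rw [← h0]
      rfl
    refine ⟨?_, ?_, ?_⟩
    · have := intervalIntegral.continuousOn_primitive_interval' hiZ left_mem_uIcc
      rw [uIcc_of_le hT.le] at this
      exact (continuousOn_const.add this).congr fun t _ => hP t
    · rw [hP]; simp
    · intro t ht
      rw [hP, hsol t ht, add_sub_add_comm, ← intervalIntegral.integral_sub (int_sub hiZ ht)
        (int_sub hiy ht)]
      set D := (1 - q)⁻¹ * ‖x₀ - y 0‖ + q ^ (k + 1) * B with hD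
      have hD0 : 0 ≤ D := by positivity
      have hh : ‖∫ s in (0:ℝ)..t, (Frhs f (Z s) (v s) - Frhs f (y s) (v s))‖
          ≤ ((n * L + 1) * D) * |t - 0| := by
        apply intervalIntegral.norm_integral_le_of_norm_le_const
        intro s hst
        rw [uIoc_of_le ht.1] at hst
        refine (F_lip hL hfLip _ _ _).trans ?_
        gcongr
        exact hb s ⟨hst.1.le, hst.2.trans ht.2⟩
      rw [sub_zero, abs_of_nonneg ht.1] at hh
      have hh2 : (n * L + 1) * D * t ≤ q * D := by
        calc _ ≤ ((n * L + 1) * D) * T := by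
              gcongr
              exact ht.2
          _ = _ := by rw [hqdef]; ring
      refine (norm_add_le _ _).trans ?_
      have : (1 - q)⁻¹ * ‖x₀ - y 0‖ + q ^ (k + 1 + 1) * B = ‖x₀ - y 0‖ + q * D := by
        rw [hD]
        nth_rewrite 1 [hρ]
        ring
      rw [this]
      linarith

end field

/-- Proposition 2.1: accuracy of the approximate predictor `P^u_{l,m}`. -/
theorem stmt_1 (n : ℕ) (hn : 0 < n) (L r τ : ℝ) (hL : 0 ≤ L) (hr : 0 ≤ r) (hτ : 0 ≤ τ)
    (hrτ : 0 < r + τ)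
    (f : Fin n → (Fin n → ℝ) → ℝ)
    (hfLip : ∀ (i : Fin n) (x z : Fin n → ℝ),
      |f i x - f i z| ≤ L * vnorm (fun j => if (j : ℕ) ≤ (i : ℕ) then x j - z j else 0))
    (hf0 : ∀ i, f i (fun _ => 0) = 0)
    (m : ℕ) (hm : 1 ≤ m) (hT : ((n : ℝ) * L + 1) * ((r + τ) / m) < 1) :
    ∃ K : ℝ, 0 ≤ K ∧
      ∀ l : ℕ, 1 ≤ l →
        ∀ u : ℝ → ℝ, Measurable u → BddAbove ((fun s => |u s|) '' Ico 0 (r + τ)) →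
          ∀ (x : Fin n → ℝ) (xs : ℝ → Fin n → ℝ),
            xs 0 = x →
            ContinuousOn xs (Icc 0 (r + τ)) →
            (∀ t ∈ Icc (0:ℝ) (r + τ), ∀ i : Fin n,
              xs t i = x i + ∫ s in (0:ℝ)..t,
                (f i (xs s) + AshiftU (xs s) 0 i + u s * bvec n i)) →
            vnorm (PredIter f l ((r + τ) / m) u m x - xs (r + τ)) ≤
              K * (((n : ℝ) * L + 1) * ((r + τ) / m)) ^ (l + 1) /
                  (1 - ((n : ℝ) * L + 1) * ((r + τ) / m)) *
                (vnorm x + sSup ((fun s => |u s|) '' Ico 0 (r + τ))) := by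
  set R := r + τ with hR
  set T := R / m with hTdef
  have hm0 : (0:ℝ) < m := by exact_mod_cast hm
  have hT0 : 0 < T := by positivity
  have hmT : (m:ℝ) * T = R := by rw [hTdef]; field_simp
  set q : ℝ := (n * L + 1) * T with hqdef
  have hq0 : 0 ≤ q := by positivity
  have hρ0 : 0 ≤ (1 - q)⁻¹ := inv_nonneg.2 (by linarith)
  refine ⟨n * (m * (1 - q)⁻¹ ^ m * (1 - q)), ?_, ?_⟩
  · have : 0 ≤ 1 - q := by linarith
    positivity
  intro l _ u hu hbdd x xs hx0 hxc hxs
  set U := sSup ((fun s => |u s|) '' Ico 0 R) with hUdef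
  have hU : ∀ s ∈ Ico 0 R, |u s| ≤ U := fun s hs => le_csSup hbdd ⟨s, hs, rfl⟩
  have hU0 : 0 ≤ U := (abs_nonneg _).trans (hU 0 ⟨le_rfl, hrτ⟩)
  have hint := F_int hL hfLip hrτ hu hU hxc
  have hsol : ∀ t ∈ Icc 0 R, xs t = xs 0 + ∫ s in (0:ℝ)..t, Frhs f (xs s) (u s) := by
    intro t ht
    funext i
    rw [hxs t ht i, hx0, Pi.add_apply]
    congr 1
    have := (ContinuousLinearMap.proj (R := ℝ) (φ := fun _ : Fin n => ℝ) i).intervalIntegral_comp_comm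
      (int_sub hint ht)
    simp only [ContinuousLinearMap.proj_apply] at this
    rw [← this]
    simp [Frhs]
  have main : ∀ i : ℕ, i ≤ m →
      ‖xs (i * T)‖ + U ≤ (1 - q)⁻¹ ^ i * (‖x‖ + U) ∧
      ‖PredIter f l T u i x - xs (i * T)‖ ≤ i * (1 - q)⁻¹ ^ i * q ^ (l + 1) * (‖x‖ + U) := by
    intro i
    induction i with
    | zero =>
      intro _
      simp [hx0, PredIter]
    | succ i ih =>
      intro hi
      obtain ⟨ih1, ih2⟩ := ih (by omega)
      have hiT0 : 0 ≤ (i:ℝ) * T := by positivity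
      have hiT : (i:ℝ) * T + T ≤ R := by
        have : ((i + 1 : ℕ) : ℝ) ≤ m := by exact_mod_cast hi
        push_cast at this
        nlinarith
      set y : ℝ → Fin n → ℝ := fun s => xs (s + i * T) with hy
      set v : ℝ → ℝ := fun s => u (s + i * T) with hv
      have hvm : Measurable v := hu.comp (measurable_id.add_const _)
      have hvU : ∀ s ∈ Ico 0 T, |v s| ≤ U := fun s hs =>
        hU _ ⟨by linarith [hs.1], by linarith [hs.2]⟩
      have hmaps : ∀ s ∈ Icc 0 T, s + i * T ∈ Icc 0 R := fun s hs =>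
        ⟨by linarith [hs.1], by linarith [hs.2]⟩
      have hyc : ContinuousOn y (Icc 0 T) :=
        hxc.comp (by fun_prop) hmaps
      have hysol : ∀ t ∈ Icc 0 T, y t = y 0 + ∫ s in (0:ℝ)..t, Frhs f (y s) (v s) := by
        intro t ht
        have e1 := hsol _ (hmaps t ht)
        have h0m := hmaps 0 ⟨le_rfl, hT0.le⟩
        have e2 := hsol _ h0m
        have e3 := intervalIntegral.integral_comp_add_right (a := 0) (b := t)
          (fun s => Frhs f (xs s) (u s)) (i * T)
        have e4 := intervalIntegral.integral_interval_sub_left (int_sub hint (hmaps t ht))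
          (int_sub hint h0m)
        show xs (t + i * T) = xs (0 + i * T) +
          ∫ s in (0:ℝ)..t, Frhs f (xs (s + i * T)) (u (s + i * T))
        rw [e3, ← e4, e1, e2]
        abel
      obtain ⟨B, hB0, hB1, hB2, hB3⟩ := seg_bound hL hfLip hf0 hT0 hT hvU hyc hysol
      obtain ⟨_, _, hk⟩ := seg_iter hL hfLip hT0 hT hvm hvU hyc hysol hB0 hB3
        (PredIter f l T u i x) l
      have hTm : T ∈ Icc 0 T := ⟨hT0.le, le_rfl⟩
      have hyT : y T = xs ((i + 1 : ℕ) * T) := by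
        rw [hy]; push_cast; congr 1; ring
      have hy0 : y 0 = xs (i * T) := by simp [hy]
      have hb := hB2 T hTm
      have hk' := hk T hTm
      rw [hyT] at hb hk'
      rw [hy0] at hk' hB1
      have hB4 : B ≤ (1 - q)⁻¹ ^ (i + 1) * (‖x‖ + U) := by
        refine hB1.trans ?_
        rw [pow_succ', mul_assoc]
        gcongr
      refine ⟨hb.trans hB4, ?_⟩
      refine hk'.trans ?_
      calc _ ≤ (1 - q)⁻¹ * (i * (1 - q)⁻¹ ^ i * q ^ (l + 1) * (‖x‖ + U)) +
            q ^ (l + 1) * ((1 - q)⁻¹ ^ (i + 1) * (‖x‖ + U)) := by gcongr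
        _ = _ := by push_cast; ring
  obtain ⟨_, h⟩ := main m le_rfl
  rw [hmT] at h
  refine (vnorm_le_norm _).trans ?_
  have h1q : 1 - q ≠ 0 := by linarith
  calc _ ≤ n * (m * (1 - q)⁻¹ ^ m * q ^ (l + 1) * (vnorm x + U)) := by
        gcongr
        refine h.trans ?_
        gcongr
        exact norm_le_vnorm x
    _ = _ := by
        field_simp
end

section
/- Under Assumption (A), let Q∈ℝ^{n×n} be symmetric positive definite, q>0 and p∈ℝⁿ with Q(A+pc')+(A'+cp')Q+2qI ≤ 0 (as quadratic forms), and let θ ≥ max(1, 2|Q|L√n/q). Set Δ_θ:=diag(θ,θ²,…,θⁿ). Suppose e:[r,∞)→ℝⁿ is locally absolutely continuous and satisfies, for given functions x,u,d,η and almost every t≥r, the error equation ė(t) = (A+Δ_θ p c')e(t) + Δ_θ p η(t) + ( f(x(t−r)+e(t)) − f(x(t−r)) ) − diag(g₁(x(t−r),u(t−r)),…,g_n(x(t−r),u(t−r)))·d(t−r). Then V(t):=e(t)'Δ_θ^{−1}QΔ_θ^{−1}e(t) satisfies, for almost every t≥r: V̇(t) ≤ −(θq/(2|Q|))·V(t)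 + (4/(θq))·|Qp|²·η(t)² + (4G²/(θ³q))·|Q|²·|d(t−r)|². (Inequality (A.10)) -/
open MeasureTheory Set Matrix

theorem vnorm_nonneg' {n : ℕ} (v : Fin n → ℝ) : 0 ≤ vnorm v := Real.sqrt_nonneg _

theorem vnorm_sq' {n : ℕ} (v : Fin n → ℝ) : vnorm v ^ 2 = ∑ i, v i ^ 2 :=
  Real.sq_sqrt (Finset.sum_nonneg fun i _ => sq_nonneg _)

theorem vnorm_sq_dot {n : ℕ} (v : Fin n → ℝ) : v ⬝ᵥ v = vnorm v ^ 2 := by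
  rw [vnorm_sq']; simp [dotProduct, sq]

theorem vnorm_smul' {n : ℕ} (a : ℝ) (v : Fin n → ℝ) : vnorm (a • v) = |a| * vnorm v := by
  unfold vnorm
  have : ∑ i, (a • v) i ^ 2 = a ^ 2 * ∑ i, v i ^ 2 := by
    rw [Finset.mul_sum]; refine Finset.sum_congr rfl fun i _ => ?_
    simp [mul_pow]
  rw [this, Real.sqrt_mul (sq_nonneg a), Real.sqrt_sq_eq_abs]

theorem abs_dot_le {n : ℕ} (v w : Fin n → ℝ) : |v ⬝ᵥ w| ≤ vnorm v * vnorm w := by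
  apply abs_le_of_sq_le_sq
  · rw [mul_pow, vnorm_sq', vnorm_sq']
    exact Finset.sum_mul_sq_le_sq_mul_sq _ _ _
  · exact mul_nonneg (vnorm_nonneg' _) (vnorm_nonneg' _)

theorem matNorm_bdd {n : ℕ} (Q : Matrix (Fin n) (Fin n) ℝ) :
    BddAbove {c : ℝ | ∃ v : Fin n → ℝ, vnorm v = 1 ∧ c = vnorm (Q.mulVec v)} := by
  refine ⟨Real.sqrt (∑ i, ∑ j, Q i j ^ 2), ?_⟩
  rintro c ⟨v, hv, rfl⟩
  apply Real.sqrt_le_sqrt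
  refine Finset.sum_le_sum fun i _ => ?_
  have h := Finset.sum_mul_sq_le_sq_mul_sq Finset.univ (Q i) v
  rw [← vnorm_sq' v, hv] at h
  simpa [mulVec, dotProduct] using h

theorem matNorm_nonneg' {n : ℕ} (Q : Matrix (Fin n) (Fin n) ℝ) : 0 ≤ matNorm Q := by
  apply Real.sSup_nonneg
  rintro c ⟨v, hv, rfl⟩
  exact vnorm_nonneg' _

theorem vnorm_mulVec_le {n : ℕ} (Q : Matrix (Fin n) (Fin n) ℝ) (v : Fin n → ℝ) :
    vnorm (Q.mulVec v) ≤ matNorm Q * vnorm v := by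
  rcases (vnorm_nonneg' v).eq_or_lt with h | h
  · have hv : v = 0 := by
      have h2 := vnorm_sq' v
      rw [← h] at h2
      have h3 : ∑ i, v i ^ 2 = 0 := by rw [← h2]; norm_num
      rw [Finset.sum_eq_zero_iff_of_nonneg (fun i _ => sq_nonneg _)] at h3
      ext i
      simpa using h3 i (Finset.mem_univ _)
    subst hv
    rw [← h]; simp [vnorm]
  · have h1 : vnorm (Q.mulVec ((vnorm v)⁻¹ • v)) ≤ matNorm Q := by
      apply le_csSup (matNorm_bdd Q)
      refine ⟨_, ?_, rfl⟩
      rw [vnorm_smul', abs_of_pos (inv_pos.2 h), inv_mul_cancel₀ h.ne']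
    rw [mulVec_smul, vnorm_smul', abs_of_pos (inv_pos.2 h), inv_mul_le_iff₀ h] at h1
    linarith

theorem vnorm_le_of_abs {n : ℕ} (v w : Fin n → ℝ) (h : ∀ i, |v i| ≤ |w i|) :
    vnorm v ≤ vnorm w :=
  Real.sqrt_le_sqrt (Finset.sum_le_sum fun i _ => sq_le_sq.2 (h i))

theorem vnorm_le_const {n : ℕ} (v : Fin n → ℝ) (C : ℝ) (hC : 0 ≤ C) (h : ∀ i, |v i| ≤ C) :
    vnorm v ≤ Real.sqrt n * C := by
  have h1 := vnorm_le_of_abs v (fun _ => C) (fun i => (h i).trans (le_abs_self C))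
  refine h1.trans (le_of_eq ?_)
  simp [vnorm, Real.sqrt_sq hC]

theorem quad_deriv {n : ℕ} (Q : Matrix (Fin n) (Fin n) ℝ) (z : ℝ → Fin n → ℝ)
    (w : Fin n → ℝ) (t : ℝ) (h : ∀ i, HasDerivAt (fun s => z s i) (w i) t) :
    HasDerivAt (fun s => z s ⬝ᵥ Q.mulVec (z s)) (w ⬝ᵥ Q.mulVec (z t) + z t ⬝ᵥ Q.mulVec w) t := by
  simp only [dotProduct, mulVec]
  rw [← Finset.sum_add_distrib]
  apply HasDerivAt.fun_sum
  intro i _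
  apply (h i).mul
  apply HasDerivAt.fun_sum
  intro j _
  exact (h j).const_mul _

theorem Amat_mulVec {n : ℕ} (z : Fin n → ℝ) : (Amat n).mulVec z = AshiftU z 0 := by
  ext i
  simp only [Amat, mulVec, dotProduct, AshiftU, of_apply]
  split_ifs with h
  · rw [Finset.sum_eq_single ⟨(i : ℕ) + 1, h⟩]
    · simp
    · intro b _ hb
      have : (i : ℕ) + 1 ≠ b := fun hh => hb (Fin.ext hh.symm)
      simp [this]
    · simp
  · apply Finset.sum_eq_zero
    intro b _
    have : (i : ℕ) + 1 ≠ b := fun hh => h (hh ▸ b.2)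
    simp [this]

/-- The scalar estimate which finishes the argument. -/
theorem final_est (N G q θ y k a D s V S F : ℝ) (hq : 0 < q) (hθ : 1 ≤ θ) (hN : 0 ≤ N)
    (hV : V ≤ N * y ^ 2) (hS : S + q * y ^ 2 ≤ 0) (ha : |a| ≤ y * k) (hF : 2 * F ≤ q * θ * y ^ 2)
    (hD : |D| ≤ y * (N * (G * s / θ))) (η : ℝ) :
    2 * (θ * S + η * a + F - D) ≤ -(θ * q / (2 * N)) * V + (4 / (θ * q)) * k ^ 2 * η ^ 2
      + (4 * G ^ 2 / (θ ^ 3 * q)) * N ^ 2 * s ^ 2 := by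
  have hθ0 : 0 < θ := by linarith
  have hm : 0 < θ * q := mul_pos hθ0 hq
  have young : ∀ b : ℝ, 2 * (y * b) ≤ θ * q / 4 * y ^ 2 + 4 / (θ * q) * b ^ 2 := by
    intro b
    have : θ * q / 4 * y ^ 2 + 4 / (θ * q) * b ^ 2 - 2 * (y * b)
        = (θ * q * y - 4 * b) ^ 2 / (4 * (θ * q)) := by field_simp; ring
    have h2 : 0 ≤ (θ * q * y - 4 * b) ^ 2 / (4 * (θ * q)) := by positivity
    linarith
  have y1 := young (k * |η|)
  have y2 := young (N * (G * s / θ))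
  have h1 : η * a ≤ y * (k * |η|) := by
    calc η * a ≤ |η * a| := le_abs_self _
      _ = |η| * |a| := abs_mul _ _
      _ ≤ |η| * (y * k) := mul_le_mul_of_nonneg_left ha (abs_nonneg _)
      _ = _ := by ring
  have h2 : -D ≤ y * (N * (G * s / θ)) := (neg_le_abs D).trans hD
  have h3 : θ * S ≤ - (θ * q * y ^ 2) := by nlinarith
  have h4 : θ * q / (2 * N) * V ≤ θ * q / 2 * y ^ 2 := by
    rcases hN.eq_or_lt with h | h
    · rw [← h]; simp; positivity
    · calc θ * q / (2 * N) * V ≤ θ * q / (2 * N) * (N * y ^ 2) :=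
            mul_le_mul_of_nonneg_left hV (by positivity)
        _ = _ := by field_simp
  have e1 : 4 / (θ * q) * (k * |η|) ^ 2 = (4 / (θ * q)) * k ^ 2 * η ^ 2 := by
    rw [mul_pow, sq_abs]; ring
  have e2 : 4 / (θ * q) * (N * (G * s / θ)) ^ 2
      = (4 * G ^ 2 / (θ ^ 3 * q)) * N ^ 2 * s ^ 2 := by
    field_simp
  rw [e1] at y1
  rw [e2] at y2
  linarith

/-- inequality (A.10): differential inequality for the observer-error
Lyapunov function `V(t) = e(t)'Δ_θ⁻¹ Q Δ_θ⁻¹ e(t)`. -/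
theorem stmt_10 (n : ℕ) (hn : 0 < n) (L G r : ℝ) (hL : 0 ≤ L) (hG : 0 ≤ G) (hr : 0 ≤ r)
    (f : Fin n → (Fin n → ℝ) → ℝ) (g : Fin n → (Fin n → ℝ) → ℝ → ℝ)
    (hfLip : ∀ (i : Fin n) (x z : Fin n → ℝ),
      |f i x - f i z| ≤ L * vnorm (fun j => if (j : ℕ) ≤ (i : ℕ) then x j - z j else 0))
    (hf0 : ∀ i, f i (fun _ => 0) = 0)
    (hgB : ∀ i x v, |g i x v| ≤ G)
    (Q : Matrix (Fin n) (Fin n) ℝ) (q : ℝ) (p : Fin n → ℝ) (θ : ℝ)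
    (hQsym : Q.IsSymm) (hQpd : ∀ v : Fin n → ℝ, v ≠ 0 → 0 < v ⬝ᵥ Q.mulVec v)
    (hq : 0 < q)
    -- Q(A+pc') + (A'+cp')Q + 2qI ≤ 0 as quadratic forms
    (hRic : ∀ v : Fin n → ℝ,
      v ⬝ᵥ (Q * (Amat n + vecMulVec p (cvec n)) +
        (Amat n + vecMulVec p (cvec n))ᵀ * Q).mulVec v + 2 * q * (v ⬝ᵥ v) ≤ 0)
    (hθ : max 1 (2 * matNorm Q * L * Real.sqrt n / q) ≤ θ)
    (x : ℝ → Fin n → ℝ) (u : ℝ → ℝ) (d : ℝ → Fin n → ℝ) (η : ℝ → ℝ)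
    (e : ℝ → Fin n → ℝ)
    (he_cont : ContinuousOn e (Ici r))
    -- e satisfies the observer error equation (A.9) a.e. on [r,∞)
    (herr : ∀ᵐ t : ℝ, r ≤ t →
      ∀ i : Fin n, HasDerivAt (fun s => e s i)
        (AshiftU (e t) 0 i + θ ^ ((i : ℕ) + 1) * p i * ((cvec n ⬝ᵥ e t) + η t) +
          (f i (x (t - r) + e t) - f i (x (t - r))) -
          g i (x (t - r)) (u (t - r)) * d (t - r) i) t) :
    ∀ᵐ t : ℝ, r ≤ t →
      ∃ V' : ℝ,
        HasDerivAt (fun s =>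
          (fun i => e s i / θ ^ ((i : ℕ) + 1)) ⬝ᵥ
            Q.mulVec (fun i => e s i / θ ^ ((i : ℕ) + 1))) V' t ∧
        V' ≤ -(θ * q / (2 * matNorm Q)) *
            ((fun i => e t i / θ ^ ((i : ℕ) + 1)) ⬝ᵥ
              Q.mulVec (fun i => e t i / θ ^ ((i : ℕ) + 1))) +
          (4 / (θ * q)) * vnorm (Q.mulVec p) ^ 2 * (η t) ^ 2 +
          (4 * G ^ 2 / (θ ^ 3 * q)) * matNorm Q ^ 2 * vnorm (d (t - r)) ^ 2 := by
  have hθ1 : 1 ≤ θ := (le_max_left _ _).trans hθ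
  have hθ0 : 0 < θ := by linarith
  have hθ2 : 2 * matNorm Q * L * Real.sqrt n ≤ θ * q :=
    (div_le_iff₀ hq).1 ((le_max_right _ _).trans hθ)
  have hN := matNorm_nonneg' Q
  filter_upwards [herr] with t ht hrt
  specialize ht hrt
  set z : Fin n → ℝ := fun i => e t i / θ ^ ((i : ℕ) + 1) with hz
  set F : Fin n → ℝ := fun i => (f i (x (t - r) + e t) - f i (x (t - r))) / θ ^ ((i : ℕ) + 1)
    with hF
  set D : Fin n → ℝ := fun i =>
    g i (x (t - r)) (u (t - r)) * d (t - r) i / θ ^ ((i : ℕ) + 1) with hD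
  set M := Amat n + vecMulVec p (cvec n) with hM
  set w : Fin n → ℝ := θ • M.mulVec z + η t • p + F - D with hw
  have hpow : ∀ k : ℕ, 0 < θ ^ k := fun k => pow_pos hθ0 k
  have hce : cvec n ⬝ᵥ e t = θ * (cvec n ⬝ᵥ z) := by
    simp only [dotProduct, Finset.mul_sum]
    refine Finset.sum_congr rfl fun i _ => ?_
    by_cases h : (i : ℕ) = 0
    · simp [cvec, hz, h]; field_simp
    · simp [cvec, h]
  have hsh : ∀ i : Fin n, AshiftU (e t) 0 i / θ ^ ((i : ℕ) + 1) = θ * AshiftU z 0 i := by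
    intro i
    simp only [AshiftU]
    split_ifs with h
    · simp only [hz]
      have := hpow ((i : ℕ) + 1)
      rw [pow_succ θ ((i : ℕ) + 1)]
      field_simp
    · simp
  have hder : ∀ i, HasDerivAt (fun s => e s i / θ ^ ((i : ℕ) + 1)) (w i) t := by
    intro i
    refine ((ht i).div_const (θ ^ ((i : ℕ) + 1))).congr_deriv ?_
    symm
    have h1 : M.mulVec z i = AshiftU z 0 i + p i * (cvec n ⬝ᵥ z) := by
      rw [hM, add_mulVec, Amat_mulVec, vecMulVec_mulVec]
      simp [mul_comm]
    simp only [hw, Pi.add_apply, Pi.sub_apply, Pi.smul_apply, smul_eq_mul, h1]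
    rw [hce, sub_div, add_div, add_div, hsh]
    simp only [hF, hD]
    have := hpow ((i : ℕ) + 1)
    field_simp
    ring
  have hsymm : ∀ a b : Fin n → ℝ, a ⬝ᵥ Q.mulVec b = b ⬝ᵥ Q.mulVec a := by
    intro a b
    rw [dotProduct_mulVec, ← mulVec_transpose, hQsym.eq, dotProduct_comm]
  refine ⟨_, quad_deriv Q (fun s i => e s i / θ ^ ((i : ℕ) + 1)) w t hder, ?_⟩
  change w ⬝ᵥ Q.mulVec z + z ⬝ᵥ Q.mulVec w ≤ -(θ * q / (2 * matNorm Q)) * (z ⬝ᵥ Q.mulVec z) + _ + _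
  have hy := vnorm_nonneg' z
  have hQ : ∀ v, |z ⬝ᵥ Q.mulVec v| ≤ vnorm z * (matNorm Q * vnorm v) := fun v =>
    (abs_dot_le _ _).trans (mul_le_mul_of_nonneg_left (vnorm_mulVec_le _ _) hy)
  have hlin : z ⬝ᵥ Q.mulVec w = θ * (z ⬝ᵥ Q.mulVec (M.mulVec z)) + η t * (z ⬝ᵥ Q.mulVec p)
      + z ⬝ᵥ Q.mulVec F - z ⬝ᵥ Q.mulVec D := by
    rw [hw]
    simp only [mulVec_sub, mulVec_add, mulVec_smul, dotProduct_sub, dotProduct_add,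
      dotProduct_smul, smul_eq_mul]
  have hR : z ⬝ᵥ Q.mulVec (M.mulVec z) + q * vnorm z ^ 2 ≤ 0 := by
    have h := hRic z
    rw [vnorm_sq_dot, add_mulVec, dotProduct_add, ← mulVec_mulVec, ← mulVec_mulVec] at h
    have h2 : z ⬝ᵥ Mᵀ.mulVec (Q.mulVec z) = z ⬝ᵥ Q.mulVec (M.mulVec z) := by
      rw [dotProduct_mulVec, vecMul_transpose, hsymm]
    rw [h2] at h
    linarith
  have hFn : vnorm F ≤ Real.sqrt n * (L * vnorm z) := by
    apply vnorm_le_const _ _ (mul_nonneg hL hy)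
    intro i
    simp only [hF]
    rw [abs_div, abs_of_pos (hpow _), div_le_iff₀ (hpow _)]
    refine (hfLip i _ _).trans ?_
    rw [mul_assoc]
    refine mul_le_mul_of_nonneg_left ?_ hL
    have : vnorm z * θ ^ ((i : ℕ) + 1) = vnorm (θ ^ ((i : ℕ) + 1) • z) := by
      rw [vnorm_smul', abs_of_pos (hpow _), mul_comm]
    rw [this]
    apply vnorm_le_of_abs
    intro j
    split_ifs with hj
    · simp only [Pi.add_apply, add_sub_cancel_left, Pi.smul_apply, smul_eq_mul, hz]
      rw [abs_mul, abs_div, abs_of_pos (hpow _), abs_of_pos (hpow _), mul_div_assoc', 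
        le_div_iff₀ (hpow _), mul_comm]
      exact mul_le_mul_of_nonneg_right (pow_le_pow_right₀ hθ1 (by omega)) (abs_nonneg _)
    · rw [abs_zero]; exact abs_nonneg _
  have hDn : vnorm D ≤ G * vnorm (d (t - r)) / θ := by
    have : G * vnorm (d (t - r)) / θ = vnorm ((G / θ) • d (t - r)) := by
      rw [vnorm_smul', abs_of_nonneg (by positivity)]; ring
    rw [this]
    apply vnorm_le_of_abs
    intro i
    simp only [hD, Pi.smul_apply, smul_eq_mul]
    rw [abs_div, abs_mul, abs_mul, abs_of_pos (hpow _), abs_of_nonneg (by positivity : 0 ≤ G / θ),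
      div_mul_eq_mul_div]
    have h1 : θ ≤ θ ^ ((i : ℕ) + 1) := le_self_pow₀ hθ1 (by omega)
    have h2 := hgB i (x (t - r)) (u (t - r))
    gcongr
  rw [hsymm w z, ← two_mul, hlin]
  refine final_est (matNorm Q) G q θ (vnorm z) (vnorm (Q.mulVec p)) _ _ (vnorm (d (t - r))) _ _ _
    hq hθ1 hN ?_ hR (abs_dot_le _ _) ?_ ?_ (η t)
  · exact ((le_abs_self _).trans (hQ z)).trans (le_of_eq (by ring))
  · have h1 := (le_abs_self _).trans (hQ F)
    have h2 : vnorm z * (matNorm Q * vnorm F)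
        ≤ vnorm z * (matNorm Q * (Real.sqrt n * (L * vnorm z))) := by gcongr
    have h3 := mul_le_mul_of_nonneg_right hθ2 (sq_nonneg (vnorm z))
    linarith
  · exact (hQ D).trans (by gcongr)
end

section
/- Under Assumption (A), let k∈ℝⁿ, a symmetric positive definite matrix P∈ℝ^{n×n} and constants μ,γ>0 satisfy condition (2.15). Then along every solution x of system (1.4), the function V(t):=x(t)'Px(t) satisfies for almost all t≥0: V̇(t) ≤ −2μ·V(t) + (b'Pb/(2μ))·( u(t−τ) − k'x(t) )² + 2γ·|d(t)|². (Inequality (2.28)) -/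
open MeasureTheory Set Matrix

/-- inequality (2.28): differential inequality for `V(t) = x(t)'Px(t)`
along solutions of (1.4), under condition (2.15). -/
theorem stmt_14 (n : ℕ) (hn : 0 < n) (L G τ : ℝ) (hL : 0 ≤ L) (hG : 0 ≤ G) (hτ : 0 ≤ τ)
    (f : Fin n → (Fin n → ℝ) → ℝ) (g : Fin n → (Fin n → ℝ) → ℝ → ℝ)
    (hfLip : ∀ (i : Fin n) (x z : Fin n → ℝ),
      |f i x - f i z| ≤ L * vnorm (fun j => if (j : ℕ) ≤ (i : ℕ) then x j - z j else 0))
    (hf0 : ∀ i, f i (fun _ => 0) = 0)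
    (hgB : ∀ i x v, |g i x v| ≤ G)
    (P : Matrix (Fin n) (Fin n) ℝ) (k : Fin n → ℝ) (μ γ : ℝ)
    (hPsym : P.IsSymm) (hPpd : ∀ v : Fin n → ℝ, v ≠ 0 → 0 < v ⬝ᵥ P.mulVec v)
    (hμ : 0 < μ) (hγ : 0 < γ)
    -- condition (2.15)
    (h215 : ∀ (v dd : Fin n → ℝ) (uu : ℝ),
      v ⬝ᵥ (P * (Amat n + vecMulVec (bvec n) k)).mulVec v +
        v ⬝ᵥ P.mulVec (fun i => f i v) +
        v ⬝ᵥ P.mulVec (fun i => g i v uu * dd i) ≤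
      -2 * μ * (v ⬝ᵥ P.mulVec v) + γ * vnorm dd ^ 2)
    (u : ℝ → ℝ) (d : ℝ → Fin n → ℝ)
    (x : ℝ → Fin n → ℝ)
    -- x solves (1.4) a.e. on [0,∞)
    (hx_sol : ∀ᵐ t : ℝ, 0 ≤ t →
      ∀ i : Fin n, HasDerivAt (fun s => x s i)
        (f i (x t) + g i (x t) (u t) * d t i + AshiftU (x t) (u (t - τ)) i) t) :
    ∀ᵐ t : ℝ, 0 ≤ t →
      ∃ V' : ℝ, HasDerivAt (fun s => x s ⬝ᵥ P.mulVec (x s)) V' t ∧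
        V' ≤ -2 * μ * (x t ⬝ᵥ P.mulVec (x t)) +
          (bvec n ⬝ᵥ P.mulVec (bvec n)) / (2 * μ) * (u (t - τ) - k ⬝ᵥ x t) ^ 2 +
          2 * γ * vnorm (d t) ^ 2 := by
  filter_upwards [hx_sol] with t ht h0
  have hd := ht h0
  set y := x t with hy
  set D : Fin n → ℝ := fun i =>
    f i y + g i y (u t) * d t i + AshiftU y (u (t - τ)) i with hD
  set w := u (t - τ) - k ⬝ᵥ y with hw
  have hswap : ∀ a c : Fin n → ℝ, a ⬝ᵥ P.mulVec c = c ⬝ᵥ P.mulVec a := by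
    intro a c
    rw [Matrix.dotProduct_mulVec, ← Matrix.mulVec_transpose, hPsym.eq, dotProduct_comm]
  have hDeq : D = (Amat n + vecMulVec (bvec n) k).mulVec y + (fun i => f i y)
      + (fun i => g i y (u t) * d t i) + w • bvec n := by
    have hA : AshiftU y (u (t - τ)) = (Amat n).mulVec y + u (t - τ) • bvec n := by
      funext i
      simp only [AshiftU, Pi.add_apply, Pi.smul_apply, smul_eq_mul, bvec, Matrix.mulVec,
        dotProduct, Amat, Matrix.of_apply]
      by_cases h : (i : ℕ) + 1 < n
      · rw [Finset.sum_eq_single (⟨(i : ℕ) + 1, h⟩ : Fin n)]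
        · simp [h, h.ne]
        · intro j _ hj
          have : ¬ ((i : ℕ) + 1 = (j : ℕ)) := fun e => hj (Fin.ext e.symm)
          simp [this]
        · simp
      · have e : (i : ℕ) + 1 = n := by omega
        have hz : ∀ j : Fin n, ¬ ((i : ℕ) + 1 = (j : ℕ)) := fun j => by omega
        rw [dif_neg h, if_pos e, Finset.sum_eq_zero]
        · ring
        · intro j _
          rw [if_neg (hz j)]; ring
    have hB : (vecMulVec (bvec n) k).mulVec y = (k ⬝ᵥ y) • bvec n := by
      funext i
      simp only [Matrix.mulVec, dotProduct, vecMulVec_apply, Pi.smul_apply, smul_eq_mul,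
        Finset.sum_mul]
      exact Finset.sum_congr rfl fun j _ => by ring
    funext i
    simp only [hD, hA, Matrix.add_mulVec, hB, hw, Pi.add_apply, Pi.smul_apply, smul_eq_mul]
    ring
  have hnn : 0 ≤ ((2 * μ) • y - w • bvec n) ⬝ᵥ P.mulVec ((2 * μ) • y - w • bvec n) := by
    by_cases hz : (2 * μ) • y - w • bvec n = 0
    · rw [hz]; simp
    · exact (hPpd _ hz).le
  have hder : HasDerivAt (fun s => x s ⬝ᵥ P.mulVec (x s)) (D ⬝ᵥ P.mulVec y + y ⬝ᵥ P.mulVec D) t := by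
    have hm : ∀ i, HasDerivAt (fun s => P.mulVec (x s) i) (P.mulVec D i) t := by
      intro i
      simp only [Matrix.mulVec, dotProduct]
      exact HasDerivAt.fun_sum fun j _ => (hd j).const_mul (P i j)
    have := HasDerivAt.fun_sum (u := Finset.univ) fun i _ => (hd i).mul (hm i)
    simp only [dotProduct, ← Finset.sum_add_distrib]
    exact this
  refine ⟨_, hder, ?_⟩
  rw [hswap D y]
  have h1 := h215 y (d t) (u t)
  rw [← Matrix.mulVec_mulVec] at h1
  have hexp : y ⬝ᵥ P.mulVec D = y ⬝ᵥ P.mulVec ((Amat n + vecMulVec (bvec n) k).mulVec y)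
      + y ⬝ᵥ P.mulVec (fun i => f i y) + y ⬝ᵥ P.mulVec (fun i => g i y (u t) * d t i)
      + w * (y ⬝ᵥ P.mulVec (bvec n)) := by
    rw [hDeq]
    simp only [Matrix.mulVec_add, Matrix.mulVec_smul, dotProduct_add, dotProduct_smul, smul_eq_mul]
  simp only [Matrix.mulVec_sub, Matrix.mulVec_smul, dotProduct_sub, sub_dotProduct,
    dotProduct_smul, smul_dotProduct, smul_eq_mul, hswap (bvec n) y] at hnn
  have hy2 : 2 * (w * (y ⬝ᵥ P.mulVec (bvec n))) ≤ 2 * μ * (y ⬝ᵥ P.mulVec y)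
      + (bvec n ⬝ᵥ P.mulVec (bvec n)) / (2 * μ) * w ^ 2 := by
    have hq : 0 ≤ 2 * μ * (y ⬝ᵥ P.mulVec y)
      + (bvec n ⬝ᵥ P.mulVec (bvec n)) / (2 * μ) * w ^ 2
      - 2 * (w * (y ⬝ᵥ P.mulVec (bvec n))) := by
      have := div_nonneg hnn (by positivity : (0:ℝ) ≤ 2 * μ)
      refine this.trans_eq ?_
      field_simp
      ring
    linarith
  linarith
end
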